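/- For every complex number q with |q| < 1, one has θ₂(q)⁸ + θ₃(q)⁸ + θ₄(q)⁸ = 2·(1 + 240 ∑_{n=1}^∞ n³ q^{2n}/(1-q^{2n})). -/

import Mathlib

open Complex

/-- Jacobi theta nullwert `θ₂(q) = ∑_{n ∈ ℤ} q^{(n+1/2)²}` (principal powers). -/
noncomputable def theta2 (q : ℂ) : ℂ := ∑' n : ℤ, q ^ ((((n : ℂ) + 1 / 2) ^ 2 : ℂ))

/-- Jacobi theta nullwert `θ₃(q) = ∑_{n ∈ ℤ} q^{n²}`. -/
noncomputable def theta3 (q : ℂ) : ℂ := ∑' n : ℤ, q ^ (n ^ 2)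

/-- Jacobi theta nullwert `θ₄(q) = ∑_{n ∈ ℤ} (-1)ⁿ q^{n²}`. -/
noncomputable def theta4 (q : ℂ) : ℂ := ∑' n : ℤ, (-1) ^ n * q ^ (n ^ 2)

section helpers

open UpperHalfPlane hiding I
open ModularForm SlashInvariantForm SlashInvariantFormClass ModularFormClass
  MatrixGroups OnePoint Filter EisensteinSeries Asymptotics ModularGroup

open scoped Topology Manifold Real ArithmeticFunction.sigma

/-- The weight four form `θ₃⁸ + θ₄⁸ + θ₂⁸` on the complex plane. -/
noncomputable def thetaSumC (τ : ℂ) : ℂ :=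
  jacobiTheta₂ 0 τ ^ 8 + jacobiTheta₂ (1 / 2) τ ^ 8 +
    cexp (2 * π * I * τ) * jacobiTheta₂ (τ / 2) τ ^ 8

lemma jt_add_one (z τ : ℂ) : jacobiTheta₂ z (τ + 1) = jacobiTheta₂ (z + 1 / 2) τ := by
  unfold jacobiTheta₂
  refine tsum_congr fun n ↦ ?_
  unfold jacobiTheta₂_term
  obtain ⟨m, hm⟩ := Int.even_mul_succ_self (n - 1)
  have hm' : ((n : ℂ) - 1) * n = m + m := by
    have : (n - 1) * n = m + m := by rw [← hm]; ring
    exact_mod_cast this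
  rw [Complex.exp_eq_exp_iff_exists_int]
  refine ⟨m, ?_⟩
  linear_combination (π * I) * hm'

lemma thetaSumC_add_one (τ : ℂ) : thetaSumC (τ + 1) = thetaSumC τ := by
  unfold thetaSumC
  have e : cexp (2 * π * I * (τ + 1)) = cexp (2 * π * I * τ) := by
    rw [mul_add, Complex.exp_add, mul_one, Complex.exp_two_pi_mul_I, mul_one]
  rw [jt_add_one, jt_add_one, jt_add_one, e,
    show (1 / 2 + 1 / 2 : ℂ) = 0 + 1 by norm_num, jacobiTheta₂_add_left,
    show (τ + 1) / 2 + 1 / 2 = τ / 2 + 1 by ring, jacobiTheta₂_add_left, zero_add]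
  ring

lemma jt_pow_eight (z : ℂ) {τ : ℂ} (hτ : τ ≠ 0) : jacobiTheta₂ z τ ^ 8 =
    (τ ^ 4)⁻¹ * cexp (-8 * π * I * z ^ 2 / τ) * jacobiTheta₂ (z / τ) (-1 / τ) ^ 8 := by
  rw [jacobiTheta₂_functional_equation z τ, mul_pow, mul_pow, ← Complex.exp_nat_mul, div_pow,
    ← Complex.cpow_nat_mul]
  have h1 : (-I * τ) ^ (((8 : ℕ) : ℂ) * (1 / 2)) = τ ^ 4 := by
    rw [show (((8 : ℕ) : ℂ) * (1 / 2)) = ((4 : ℕ) : ℂ) by norm_num, Complex.cpow_natCast, mul_pow]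
    rw [show (-I) ^ 4 = 1 by rw [neg_pow, Complex.I_pow_four]; norm_num, one_mul]
  rw [h1]
  congr 2
  · simp
  · congr 1; push_cast; ring

lemma thetaSumC_S {τ : ℂ} (hτ : τ ≠ 0) : thetaSumC τ = (τ ^ 4)⁻¹ * thetaSumC (-1 / τ) := by
  unfold thetaSumC
  rw [jt_pow_eight 0 hτ, jt_pow_eight (1 / 2) hτ, jt_pow_eight (τ / 2) hτ]
  have e1 : cexp (-8 * π * I * 0 ^ 2 / τ) = 1 := by simp
  have e2 : cexp (-8 * π * I * (1 / 2) ^ 2 / τ) = cexp (2 * π * I * (-1 / τ)) := by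
    congr 1; ring
  have e3 : cexp (2 * π * I * τ) * cexp (-8 * π * I * (τ / 2) ^ 2 / τ) = 1 := by
    rw [← Complex.exp_add, Complex.exp_eq_one_iff]
    refine ⟨0, ?_⟩
    field_simp
    push_cast
    ring
  have e4 : jacobiTheta₂ (1 / 2 / τ) (-1 / τ) = jacobiTheta₂ (-1 / τ / 2) (-1 / τ) := by
    rw [← jacobiTheta₂_neg_left]; congr 1; ring
  have e5 : τ / 2 / τ = 1 / 2 := by field_simp
  rw [e1, e2, e4, e5, zero_div]
  linear_combination (τ ^ 4)⁻¹ * jacobiTheta₂ (1 / 2) (-1 / τ) ^ 8 * e3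

lemma thetaSumC_differentiableAt {τ : ℂ} (hτ : 0 < τ.im) : DifferentiableAt ℂ thetaSumC τ := by
  unfold thetaSumC
  have h1 := differentiableAt_jacobiTheta₂_snd 0 hτ
  have h2 := differentiableAt_jacobiTheta₂_snd (1 / 2) hτ
  have h3 : DifferentiableAt ℂ (fun t : ℂ ↦ jacobiTheta₂ (t / 2) t) τ := by
    have h := (hasFDerivAt_jacobiTheta₂ (τ / 2) hτ).differentiableAt
    have h' : DifferentiableAt ℂ (fun t : ℂ ↦ (t / 2, t)) τ := by fun_prop
    exact DifferentiableAt.comp (g := fun p : ℂ × ℂ ↦ jacobiTheta₂ p.1 p.2)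
      (f := fun t : ℂ ↦ (t / 2, t)) τ h h'
  fun_prop

lemma tendsto_jt_zero : Tendsto (fun τ : ℂ ↦ jacobiTheta₂ 0 τ) (comap Complex.im atTop) (𝓝 1) := by
  have h := isBigO_at_im_infty_jacobiTheta_sub_one
  have h2 : Tendsto (fun τ : ℂ ↦ Real.exp (-π * τ.im)) (comap Complex.im atTop) (𝓝 0) := by
    refine Real.tendsto_exp_atBot.comp ?_
    exact (tendsto_id.const_mul_atTop_of_neg (by simpa using Real.pi_pos)).comp tendsto_comap
  have h3 := (h.trans_tendsto h2).add_const 1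
  simpa [jacobiTheta_eq_jacobiTheta₂] using h3

lemma tendsto_jt_half :
    Tendsto (fun τ : ℂ ↦ jacobiTheta₂ (1 / 2) τ) (comap Complex.im atTop) (𝓝 1) := by
  have h : Tendsto (fun τ : ℂ ↦ τ + 1) (comap Complex.im atTop) (comap Complex.im atTop) := by
    rw [tendsto_comap_iff]
    simpa [Function.comp_def] using tendsto_comap
  refine (tendsto_jt_zero.comp h).congr fun τ ↦ ?_
  simp only [Function.comp_apply]
  rw [jt_add_one, zero_add]

lemma jt_bound : ∃ C : ℝ, ∀ τ : ℂ, 1 ≤ τ.im → ‖jacobiTheta₂ (τ / 2) τ‖ ≤ C := by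
  have hs := ((summable_jacobiTheta₂_term_iff (I / 2) I).mpr (by simp)).norm
  refine ⟨_, fun τ hτ ↦ tsum_of_norm_bounded hs.hasSum fun n ↦ ?_⟩
  rw [norm_jacobiTheta₂_term, norm_jacobiTheta₂_term]
  apply Real.exp_le_exp.mpr
  have h1 : (τ / 2).im = τ.im / 2 := by simp
  have h2 : (I / 2).im = 1 / 2 := by simp
  rw [h1, h2, Complex.I_im]
  have hn : (0 : ℝ) ≤ (n : ℝ) ^ 2 + n := by
    have : 0 ≤ n ^ 2 + n := by
      rcases le_or_gt 0 n with h | h <;> nlinarith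
    exact_mod_cast this
  have := mul_nonneg (mul_nonneg Real.pi_pos.le hn) (sub_nonneg.mpr hτ)
  nlinarith

lemma tendsto_thetaSumC : Tendsto thetaSumC (comap Complex.im atTop) (𝓝 2) := by
  have h3 : Tendsto (fun τ : ℂ ↦ cexp (2 * π * I * τ) * jacobiTheta₂ (τ / 2) τ ^ 8)
      (comap Complex.im atTop) (𝓝 0) := by
    obtain ⟨C, hC⟩ := jt_bound
    have hb : (fun τ : ℂ ↦ jacobiTheta₂ (τ / 2) τ ^ 8) =O[comap Complex.im atTop]
        (fun _ ↦ (1 : ℂ)) := by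
      refine IsBigO.of_bound (C ^ 8) ?_
      filter_upwards [tendsto_comap.eventually (eventually_ge_atTop (1 : ℝ))] with τ hτ
      have := hC τ hτ
      rw [norm_pow, norm_one, mul_one]
      gcongr
    have he : Tendsto (fun τ : ℂ ↦ cexp (2 * π * I * τ)) (comap Complex.im atTop) (𝓝 0) := by
      rw [tendsto_zero_iff_norm_tendsto_zero]
      have : (fun τ : ℂ ↦ ‖cexp (2 * π * I * τ)‖) = fun τ ↦ Real.exp ((-(2 * π)) * τ.im) := by
        funext τ
        rw [Complex.norm_exp]
        congr 1
        simp
      rw [this]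
      refine Real.tendsto_exp_atBot.comp ?_
      exact (tendsto_id.const_mul_atTop_of_neg (by simpa using Real.pi_pos)).comp tendsto_comap
    have := (isBigO_refl (fun τ : ℂ ↦ cexp (2 * π * I * τ)) (comap Complex.im atTop)).mul hb
    refine this.trans_tendsto ?_
    have h0 := he
    simpa using h0
  have := ((tendsto_jt_zero.pow 8).add (tendsto_jt_half.pow 8)).add h3
  have e : (1 : ℂ) ^ 8 + 1 ^ 8 + 0 = 2 := by norm_num
  rw [e] at this
  exact this

/-- The weight four function on the upper half plane. -/
noncomputable def thetaSumH (τ : ℍ) : ℂ := thetaSumC τ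

lemma thetaSumH_slash (γ : SL(2, ℤ)) : thetaSumH ∣[(4 : ℤ)] γ = thetaSumH := by
  refine slash_action_generators_SL2Z ?_ ?_ γ
  · ext τ
    have h0 : (τ : ℂ) ≠ 0 := τ.ne_zero
    rw [SL_slash_apply, modular_S_smul, denom_S]
    simp only [thetaSumH]
    rw [thetaSumC_S h0, UpperHalfPlane.coe_mk, show (-(τ : ℂ))⁻¹ = -1 / τ by
      rw [inv_neg, neg_div, one_div], mul_comm, zpow_neg]
    rfl
  · ext τ
    have hd : denom T τ = 1 := by
      rw [ModularGroup.denom_apply]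
      simp [ModularGroup.T]
    rw [SL_slash_apply, hd, modular_T_smul]
    simp only [thetaSumH, one_zpow, mul_one]
    rw [← thetaSumC_add_one (τ : ℂ), coe_vadd]
    congr 1
    push_cast
    ring

lemma tendsto_thetaSumH : Tendsto thetaSumH atImInfty (𝓝 2) :=
  tendsto_thetaSumC.comp tendsto_coe_atImInfty

/-- The level one weight four modular form. -/
noncomputable def thetaSumForm : ModularForm 𝒮ℒ 4 where
  toFun := thetaSumH
  slash_action_eq' := fun _ ⟨γ, hγ⟩ ↦ hγ ▸ thetaSumH_slash γ
  holo' := fun τ ↦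
    (thetaSumC_differentiableAt τ.2).mdifferentiableAt.comp τ τ.mdifferentiable_coe
  bdd_at_cusps' {c} hc := by
    rw [Subgroup.IsArithmetic.isCusp_iff_isCusp_SL2Z] at hc
    rw [isBoundedAt_iff_forall_SL2Z hc]
    intro γ _
    rw [thetaSumH_slash γ]
    exact tendsto_thetaSumH.isBigO_one ℝ

lemma thetaSumForm_coeff_zero : (qExpansion 1 thetaSumForm).coeff 0 = 2 := by
  rw [UpperHalfPlane.qExpansion_coeff_zero one_pos
    (ModularFormClass.analyticAt_cuspFunction_zero thetaSumForm one_pos one_mem_strictPeriods_SL)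
    (SlashInvariantFormClass.periodic_comp_ofComplex thetaSumForm one_mem_strictPeriods_SL)]
  exact tendsto_thetaSumH.limUnder_eq

lemma thetaSumH_eq (τ : ℍ) : thetaSumH τ = 2 * E₄ τ := by
  obtain ⟨c, hc⟩ : ∃ c : ℂ, c • E₄ = thetaSumForm :=
    (finrank_eq_one_iff_of_nonzero' E₄ (E_ne_zero _ ⟨2, rfl⟩)).mp
      (Module.rank_eq_one_iff_finrank_eq_one.mp levelOne_weight_four_rank_one) _
  have h : c • qExpansion 1 (E₄ : ℍ → ℂ) = qExpansion 1 thetaSumForm := by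
    rw [← ModularForm.qExpansion_smul one_pos one_mem_strictPeriods_SL c E₄,
      show (c • E₄ : ℍ → ℂ) = thetaSumForm from congrArg DFunLike.coe hc]
  have h2 := congrArg (PowerSeries.coeff 0) h
  rw [thetaSumForm_coeff_zero, PowerSeries.coeff_smul,
    E_qExpansion_coeff_zero _ ⟨2, rfl⟩, smul_eq_mul, mul_one] at h2
  rw [← h2]
  exact (DFunLike.congr_fun hc τ).symm

lemma E₄_eq_lambert (τ : ℍ) : E₄ τ = 1 + 240 * ∑' n : ℕ,
    ((n : ℂ) + 1) ^ 3 * cexp (2 * π * I * τ) ^ (n + 1) /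
      (1 - cexp (2 * π * I * τ) ^ (n + 1)) := by
  have h := q_expansion_bernoulli (by norm_num : 3 ≤ 4) ⟨2, rfl⟩ τ
  simp_rw [zpow_natCast] at h
  rw [show (4 - 1 : ℕ) = 3 from rfl,
    ← tsum_pow_div_one_sub_eq_tsum_sigma (norm_exp_two_pi_I_lt_one τ) 3] at h
  rw [tsum_pnat_eq_tsum_succ (f := fun n : ℕ ↦ (n : ℂ) ^ 3 * cexp (2 * π * I * τ) ^ n /
      (1 - cexp (2 * π * I * τ) ^ n))] at h
  rw [bernoulli_eq_bernoulli'_of_ne_one (by norm_num), bernoulli'_four] at h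
  rw [h]
  push_cast
  ring

lemma theta_main (q : ℂ) (hq : ‖q‖ < 1) (h0 : q ≠ 0) :
    theta2 q ^ 8 + theta3 q ^ 8 + theta4 q ^ 8 =
      2 * (1 + 240 * ∑' n : ℕ,
        ((n : ℂ) + 1) ^ 3 * q ^ (2 * (n + 1)) / (1 - q ^ (2 * (n + 1)))) := by
  have hpi : (π : ℂ) ≠ 0 := by exact_mod_cast Real.pi_ne_zero
  have hlog : Real.log ‖q‖ < 0 := Real.log_neg (norm_pos_iff.mpr h0) hq
  obtain ⟨t, ht⟩ : ∃ t : ℂ, π * I * t = log q := ⟨log q / (π * I), by field_simp⟩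
  have htim : 0 < t.im := by
    have := congrArg Complex.re ht
    rw [Complex.log_re] at this
    simp at this
    have hp := Real.pi_pos
    by_contra! hcon
    nlinarith
  have hqe : q = cexp (π * I * t) := by rw [ht, Complex.exp_log h0]
  have hq2 : q ^ 2 = cexp (2 * π * I * t) := by
    rw [hqe, ← Complex.exp_nat_mul]; congr 1; push_cast; ring
  have t3 : theta3 q = jacobiTheta₂ 0 t := by
    refine tsum_congr fun n ↦ ?_
    rw [jacobiTheta₂_term, hqe, ← Complex.exp_int_mul]
    congr 1; push_cast; ring
  have t4 : theta4 q = jacobiTheta₂ (1 / 2) t := by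
    refine tsum_congr fun n ↦ ?_
    rw [jacobiTheta₂_term, hqe, ← Complex.exp_int_mul, ← Complex.exp_pi_mul_I,
      ← Complex.exp_int_mul, ← Complex.exp_add]
    congr 1; push_cast; ring
  have t2 : theta2 q = cexp (π * I * t / 4) * jacobiTheta₂ (t / 2) t := by
    rw [jacobiTheta₂, ← tsum_mul_left]
    refine tsum_congr fun n ↦ ?_
    rw [jacobiTheta₂_term, Complex.cpow_def_of_ne_zero h0, ← ht, ← Complex.exp_add]
    congr 1; ring
  have key := thetaSumH_eq ⟨t, htim⟩
  rw [E₄_eq_lambert] at key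
  simp only [thetaSumH, thetaSumC] at key
  simp_rw [pow_mul, hq2]
  rw [← key, t2, t3, t4, mul_pow, ← Complex.exp_nat_mul]
  rw [show ((8 : ℕ) : ℂ) * (π * I * t / 4) = 2 * π * I * t by push_cast; ring]
  ring

lemma theta_zero :
    theta2 0 ^ 8 + theta3 0 ^ 8 + theta4 0 ^ 8 =
      2 * (1 + 240 * ∑' n : ℕ,
        ((n : ℂ) + 1) ^ 3 * (0 : ℂ) ^ (2 * (n + 1)) / (1 - (0 : ℂ) ^ (2 * (n + 1)))) := by
  have t2 : theta2 0 = 0 := by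
    unfold theta2
    refine (tsum_congr fun n ↦ ?_).trans tsum_zero
    rw [Complex.zero_cpow]
    refine pow_ne_zero 2 fun h ↦ ?_
    have : (2 * n + 1 : ℂ) = 0 := by linear_combination 2 * h
    have : 2 * n + 1 = 0 := by exact_mod_cast this
    omega
  have t3 : theta3 0 = 1 := by
    unfold theta3
    rw [tsum_eq_single 0]
    · simp
    · intro n hn
      exact zero_zpow _ (pow_ne_zero 2 hn)
  have t4 : theta4 0 = 1 := by
    unfold theta4
    rw [tsum_eq_single 0]
    · simp
    · intro n hn
      rw [zero_zpow _ (pow_ne_zero 2 hn), mul_zero]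
  rw [t2, t3, t4]
  simp
  norm_num

end helpers

/-- `θ₂(q)⁸ + θ₃(q)⁸ + θ₄(q)⁸ = 2(1 + 240 ∑_{n≥1} n³ q^{2n}/(1-q^{2n}))` for `|q| < 1`. -/
theorem stmt_6 (q : ℂ) (hq : ‖q‖ < 1) :
    theta2 q ^ 8 + theta3 q ^ 8 + theta4 q ^ 8 =
      2 * (1 + 240 * ∑' n : ℕ,
        ((n : ℂ) + 1) ^ 3 * q ^ (2 * (n + 1)) / (1 - q ^ (2 * (n + 1)))) := by
  by_cases h0 : q = 0
  · subst h0
    exact theta_zero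
  · exact theta_main q hq h0
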